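/- Let n ≥ 1 and let S be an abelian subgroup of the group of units of M_{2^n}(ℂ) whose elements are all signed Pauli strings (each element of S equals ±P f for some f : Fin n → {I, X, Y, Z}), with −1 ∉ S and |S| = 2^n (i.e., S is a maximal such subgroup). Then every unitary 2^n × 2^n complex matrix U that commutes with every element of S lies in the ℂ-linear span of S; consequently, the von Neumann algebra generated by the unitary matrices commuting with S coincides with the von Neumann algebra generated by the Pauli-group centralizer of S. -/

import Mathlib

open Matrix

/-- The 2 × 2 identity matrix `I`. -/
noncomputable def PauliI : Matrix (Fin 2) (Fin 2) ℂ := 1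

/-- The Pauli spin matrix `X = [[0,1],[1,0]]`. -/
noncomputable def PauliX : Matrix (Fin 2) (Fin 2) ℂ := !![0, 1; 1, 0]

/-- The Pauli spin matrix `Y = [[0,-i],[i,0]]`. -/
noncomputable def PauliY : Matrix (Fin 2) (Fin 2) ℂ := !![0, -Complex.I; Complex.I, 0]

/-- The Pauli spin matrix `Z = [[1,0],[0,-1]]`. -/
noncomputable def PauliZ : Matrix (Fin 2) (Fin 2) ℂ := !![1, 0; 0, -1]

/-- The four single-qubit Pauli matrices `I, X, Y, Z`, indexed by `Fin 4`. -/
noncomputable def pauli : Fin 4 → Matrix (Fin 2) (Fin 2) ℂ := ![PauliI, PauliX, PauliY, PauliZ]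

/-- The Pauli string `P f = ⊗_{k < n} pauli (f k)`, the `n`-fold Kronecker (tensor)
product of single-qubit Pauli matrices, realized as a `2^n × 2^n` complex matrix
indexed by `Fin n → Fin 2`. -/
noncomputable def PauliString (n : ℕ) (f : Fin n → Fin 4) :
    Matrix (Fin n → Fin 2) (Fin n → Fin 2) ℂ :=
  Matrix.of fun i j => ∏ k, pauli (f k) (i k) (j k)

section TracelessSubgroup

variable {m : Type*} [Fintype m] [DecidableEq m]

/-- The trace of `M ↦ A * M * B` is `trace A * trace B`. -/
theorem trace_mulLeft_comp_mulRight (A B : Matrix m m ℂ) :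
    LinearMap.trace ℂ (Matrix m m ℂ) (LinearMap.mulLeft ℂ A ∘ₗ LinearMap.mulRight ℂ B) =
      A.trace * B.trace := by
  rw [LinearMap.trace_eq_matrix_trace ℂ (Matrix.stdBasis ℂ m m), Matrix.trace,
    Fintype.sum_prod_type, Matrix.trace, Matrix.trace, Finset.sum_mul_sum]
  refine Finset.sum_congr rfl fun i _ => Finset.sum_congr rfl fun j _ => ?_
  rw [Matrix.diag_apply, LinearMap.toMatrix_apply, Matrix.stdBasis_eq_single]
  change (A * ((Matrix.single i j (1 : ℂ) : Matrix m m ℂ) * B)) i j = A i i * B j j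
  simp [Matrix.mul_apply, Matrix.single_apply, ite_and]

/-- Distinct elements of a matrix group whose nontrivial elements are traceless are
linearly independent. -/
theorem linearIndependent_of_trace_eq_zero [Nonempty m] (S : Subgroup (Matrix m m ℂ)ˣ)
    (htr : ∀ s ∈ S, s ≠ 1 → (s : Matrix m m ℂ).trace = 0) :
    LinearIndependent ℂ (fun s : S => ((s : (Matrix m m ℂ)ˣ) : Matrix m m ℂ)) := by
  rw [linearIndependent_iff']
  intro T c hc t ht
  have h := congrArg (fun M => (M * ((t⁻¹ : S) : (Matrix m m ℂ)ˣ).val).trace) hc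
  simp only [Finset.sum_mul, Matrix.trace_sum, zero_mul, Matrix.trace_zero, smul_mul_assoc,
    Matrix.trace_smul] at h
  rw [Finset.sum_eq_single_of_mem t ht] at h
  · simpa [← Units.val_mul] using h
  · intro s _ hst
    rw [← Units.val_mul, ← Subgroup.coe_mul, htr _ (s * t⁻¹).2, smul_zero]
    intro h1
    exact hst (mul_inv_eq_one.mp (Subtype.ext h1))

/-- If an abelian matrix group has as many elements as the size of the matrices and its nontrivial
elements are traceless, then every matrix commuting with the group lies in its span. -/
theorem mem_span_of_commute [Nonempty m] (S : Subgroup (Matrix m m ℂ)ˣ)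
    (habel : ∀ a ∈ S, ∀ b ∈ S, a * b = b * a)
    (htr : ∀ s ∈ S, s ≠ 1 → (s : Matrix m m ℂ).trace = 0)
    (hcard : Nat.card S = Fintype.card m) (U : Matrix m m ℂ)
    (hU : ∀ s ∈ S, U * (s : Matrix m m ℂ) = (s : Matrix m m ℂ) * U) :
    U ∈ Submodule.span ℂ (Units.val '' (S : Set (Matrix m m ℂ)ˣ)) := by
  classical
  have hm : Fintype.card m ≠ 0 := Fintype.card_ne_zero
  have : Finite S := Nat.finite_of_card_ne_zero (hcard ▸ hm)
  have : Fintype S := Fintype.ofFinite S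
  rw [Nat.card_eq_fintype_card] at hcard
  have hm' : (Fintype.card m : ℂ) ≠ 0 := Nat.cast_ne_zero.mpr hm
  let C : Submodule ℂ (Matrix m m ℂ) :=
    Subalgebra.toSubmodule (Subalgebra.centralizer ℂ (Units.val '' (S : Set (Matrix m m ℂ)ˣ)))
  have hC (M : Matrix m m ℂ) : M ∈ C ↔ ∀ s ∈ S, (s : Matrix m m ℂ) * M = M * s := by
    simp [C, Subalgebra.mem_centralizer_iff]
  let A : Module.End ℂ (Matrix m m ℂ) := (Fintype.card m : ℂ)⁻¹ • ∑ s : S,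
    LinearMap.mulLeft ℂ s.1.val ∘ₗ LinearMap.mulRight ℂ (s⁻¹ : S).1.val
  have hA (M : Matrix m m ℂ) :
      A M = (Fintype.card m : ℂ)⁻¹ • ∑ s : S, s.1.val * (M * (s⁻¹ : S).1.val) := by
    simp [A]
  have hproj : LinearMap.IsProj C A := by
    refine ⟨fun M => (hC _).mpr fun t ht => ?_, fun M hM => ?_⟩
    · rw [hA, mul_smul_comm, smul_mul_assoc, Finset.mul_sum, Finset.sum_mul]
      congr 1
      refine Fintype.sum_equiv (Equiv.mulLeft (⟨t, ht⟩ : S)) _ _ fun s => ?_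
      simp [mul_assoc]
    · rw [hA]
      have h (s : S) : s.1.val * (M * (s⁻¹ : S).1.val) = M := by
        rw [← mul_assoc, (hC M).mp hM s.1 s.2, mul_assoc]
        simp
      simp only [h, Finset.sum_const, Finset.card_univ, hcard]
      rw [← Nat.cast_smul_eq_nsmul ℂ, smul_smul, inv_mul_cancel₀ hm', one_smul]
  have hfinC : Module.finrank ℂ C = Fintype.card m := by
    have h := hproj.trace
    simp only [A, map_smul, map_sum, trace_mulLeft_comp_mulRight] at h
    rw [Finset.sum_eq_single_of_mem (1 : S) (Finset.mem_univ _)] at h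
    · simp only [inv_one, Subgroup.coe_one, Units.val_one, Matrix.trace_one, smul_eq_mul,
        inv_mul_cancel_left₀ hm'] at h
      exact_mod_cast h.symm
    · intro s _ hs
      rw [htr s.1 s.2 (fun h => hs (Subtype.ext h)), zero_mul]
  have hfinS : Module.finrank ℂ
      (Submodule.span ℂ (Units.val '' (S : Set (Matrix m m ℂ)ˣ))) = Fintype.card m := by
    rw [← hcard, ← finrank_span_eq_card (linearIndependent_of_trace_eq_zero S htr),
      Set.image_eq_range]
    rfl
  have hle : Submodule.span ℂ (Units.val '' (S : Set (Matrix m m ℂ)ˣ)) ≤ C := by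
    rw [Submodule.span_le]
    rintro _ ⟨s, hs, rfl⟩
    exact (hC _).mpr fun t ht => congrArg Units.val (habel t ht s hs)
  rw [Submodule.eq_of_le_of_finrank_eq hle (hfinS.trans hfinC.symm)]
  exact (hC U).mpr fun s hs => (hU s hs).symm

end TracelessSubgroup

theorem pauli_mul_self (a : Fin 4) : pauli a * pauli a = 1 := by
  fin_cases a <;> ext i j <;> fin_cases i <;> fin_cases j <;>
    simp [pauli, PauliI, PauliX, PauliY, PauliZ]

theorem star_pauli_apply (a : Fin 4) (i j : Fin 2) : star (pauli a i j) = pauli a j i := by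
  fin_cases a <;> fin_cases i <;> fin_cases j <;>
    simp [pauli, PauliI, PauliX, PauliY, PauliZ]

theorem trace_pauli_eq_zero {a : Fin 4} (ha : a ≠ 0) : (pauli a).trace = 0 := by
  fin_cases a <;> simp [pauli, PauliX, PauliY, PauliZ, Matrix.trace] at ha ⊢

theorem prod_one_apply {n : ℕ} (i j : Fin n → Fin 2) :
    ∏ k, (1 : Matrix (Fin 2) (Fin 2) ℂ) (i k) (j k) =
      (1 : Matrix (Fin n → Fin 2) (Fin n → Fin 2) ℂ) i j := by
  simp [Matrix.one_apply, Finset.prod_ite_zero, funext_iff]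

theorem pauliString_zero (n : ℕ) : PauliString n 0 = 1 := by
  ext i j
  exact prod_one_apply i j

theorem pauliString_mul_self {n : ℕ} (f : Fin n → Fin 4) :
    PauliString n f * PauliString n f = 1 := by
  ext i j
  calc (PauliString n f * PauliString n f) i j
      = ∑ l : Fin n → Fin 2, ∏ k, pauli (f k) (i k) (l k) * pauli (f k) (l k) (j k) := by
        simp only [Matrix.mul_apply, PauliString, Matrix.of_apply, Finset.prod_mul_distrib]
    _ = ∏ k, (pauli (f k) * pauli (f k)) (i k) (j k) := by
        simp only [Matrix.mul_apply, Finset.prod_univ_sum, Fintype.piFinset_univ]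
    _ = (1 : Matrix (Fin n → Fin 2) (Fin n → Fin 2) ℂ) i j := by
        simp only [pauli_mul_self, prod_one_apply]

theorem star_pauliString {n : ℕ} (f : Fin n → Fin 4) :
    star (PauliString n f) = PauliString n f := by
  ext i j
  simp only [Matrix.star_apply, PauliString, Matrix.of_apply, star_prod, star_pauli_apply]

theorem trace_pauliString {n : ℕ} (f : Fin n → Fin 4) :
    (PauliString n f).trace = ∏ k, (pauli (f k)).trace := by
  simp only [Matrix.trace, Matrix.diag_apply, PauliString, Matrix.of_apply,
    Finset.prod_univ_sum, Fintype.piFinset_univ]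

theorem trace_pauliString_eq_zero {n : ℕ} {f : Fin n → Fin 4} (hf : f ≠ 0) :
    (PauliString n f).trace = 0 := by
  obtain ⟨k, hk⟩ := Function.ne_iff.mp hf
  rw [trace_pauliString]
  exact Finset.prod_eq_zero (Finset.mem_univ k) (trace_pauli_eq_zero hk)

theorem pauliString_mem_unitaryGroup {n : ℕ} (f : Fin n → Fin 4) :
    PauliString n f ∈ Matrix.unitaryGroup (Fin n → Fin 2) ℂ := by
  rw [Matrix.mem_unitaryGroup_iff, star_pauliString, pauliString_mul_self]

/-- For a maximal abelian subgroup `S` of signed Pauli strings with `-1 ∉ S` and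
`|S| = 2^n`, every unitary matrix commuting with every element of `S` lies in the
`ℂ`-span of `S`; consequently the von Neumann algebra (linear span) generated by
the unitary commutant of `S` coincides with that generated by the Pauli-group
centralizer of `S`. -/
theorem maximal_stabilizer_unitary_commutant (n : ℕ) (hn : 1 ≤ n)
    (S : Subgroup (Matrix (Fin n → Fin 2) (Fin n → Fin 2) ℂ)ˣ)
    (habel : ∀ a ∈ S, ∀ b ∈ S, a * b = b * a)
    (hpauli : ∀ s ∈ S, ∃ f : Fin n → Fin 4,
        (s : Matrix (Fin n → Fin 2) (Fin n → Fin 2) ℂ) = PauliString n f ∨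
        (s : Matrix (Fin n → Fin 2) (Fin n → Fin 2) ℂ) = -PauliString n f)
    (hneg : (-1 : (Matrix (Fin n → Fin 2) (Fin n → Fin 2) ℂ)ˣ) ∉ S)
    (hcard : Nat.card S = 2 ^ n) :
    (∀ U : Matrix (Fin n → Fin 2) (Fin n → Fin 2) ℂ,
        U ∈ Matrix.unitaryGroup (Fin n → Fin 2) ℂ →
        (∀ s ∈ S, U * (s : Matrix (Fin n → Fin 2) (Fin n → Fin 2) ℂ) =
          (s : Matrix (Fin n → Fin 2) (Fin n → Fin 2) ℂ) * U) →
        U ∈ Submodule.span ℂ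
          (Units.val '' (S : Set (Matrix (Fin n → Fin 2) (Fin n → Fin 2) ℂ)ˣ))) ∧
    Submodule.span ℂ
        {U : Matrix (Fin n → Fin 2) (Fin n → Fin 2) ℂ |
          U ∈ Matrix.unitaryGroup (Fin n → Fin 2) ℂ ∧
          ∀ s ∈ S, U * (s : Matrix (Fin n → Fin 2) (Fin n → Fin 2) ℂ) =
            (s : Matrix (Fin n → Fin 2) (Fin n → Fin 2) ℂ) * U} =
      Submodule.span ℂ
        {m : Matrix (Fin n → Fin 2) (Fin n → Fin 2) ℂ |
          (∃ f : Fin n → Fin 4, m = PauliString n f ∨ m = -PauliString n f) ∧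
          ∀ s ∈ S, m * (s : Matrix (Fin n → Fin 2) (Fin n → Fin 2) ℂ) =
            (s : Matrix (Fin n → Fin 2) (Fin n → Fin 2) ℂ) * m} := by
  have htr (s) (hs : s ∈ S) (h1 : s ≠ 1) :
      (s : Matrix (Fin n → Fin 2) (Fin n → Fin 2) ℂ).trace = 0 := by
    obtain ⟨f, hf⟩ := hpauli s hs
    have hf0 : f ≠ 0 := by
      rintro rfl
      rw [pauliString_zero] at hf
      rcases hf with hf | hf
      · exact h1 (Units.ext hf)
      · exact hneg ((Units.ext hf : s = -1) ▸ hs)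
    rcases hf with hf | hf <;> simp [hf, trace_pauliString_eq_zero hf0]
  have hspan := mem_span_of_commute S habel htr (by simpa using hcard)
  refine ⟨fun U _ hU => hspan U hU, le_antisymm ?_ (Submodule.span_mono ?_)⟩
  · refine Submodule.span_le.mpr fun U hU => Submodule.span_mono ?_ (hspan U hU.2)
    rintro _ ⟨s, hs, rfl⟩
    exact ⟨hpauli s hs, fun t ht => congrArg Units.val (habel s hs t ht)⟩
  · rintro _ ⟨⟨f, rfl | rfl⟩, hcomm⟩
    · exact ⟨pauliString_mem_unitaryGroup f, hcomm⟩
    · refine ⟨?_, hcomm⟩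
      rw [Matrix.mem_unitaryGroup_iff, star_neg, neg_mul_neg, star_pauliString,
        pauliString_mul_self]
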